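/- Let M^1, …, M^N ∈ ℝ^{n×n} be ultra matrices (N ≥ 1), let C be their entrywise 1-center given by C_{ij} = (max_{1≤k≤N} M^k_{ij} + min_{1≤k≤N} M^k_{ij}) / 2, and let U = Ũ(C). Then U is an ultra matrix, and for every ultra matrix V ∈ ℝ^{n×n}, max_{1≤k≤N} ‖U − M^k‖_∞ ≤ max_{1≤k≤N} ‖V − M^k‖_∞; that is, U is a 1-center for {M^1,…,M^N} within the space of ultra matrices with the sup distance (equivalently, the labeled merge tree T(C) is a 1-center for the labeled merge trees T(M^1),…,T(M^N) under the labeled interleaving distance). -/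

import Mathlib

/-- A matrix is *valid* if it is symmetric and each diagonal entry is a
minimum of its row. -/
def IsValid {n : ℕ} (M : Fin n → Fin n → ℝ) : Prop :=
  (∀ i j, M i j = M j i) ∧ (∀ i j, M i i ≤ M i j)

/-- A matrix is *ultra* if it is valid and satisfies the ultrametric-type
inequality `M i j ≤ max (M i k) (M k j)`. -/
def IsUltra {n : ℕ} (M : Fin n → Fin n → ℝ) : Prop :=
  IsValid M ∧ ∀ i j k, M i j ≤ max (M i k) (M k j)

/-- The value of a path `v 0, …, v k`: the maximum of the edge weights
`M (v l) (v (l+1))` together with the diagonal entries at the two endpoints. -/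
def pathVal {n : ℕ} (M : Fin n → Fin n → ℝ) {k : ℕ} (v : Fin (k + 1) → Fin n) : ℝ :=
  Finset.univ.fold max
    (max (M (v 0) (v 0)) (M (v (Fin.last k)) (v (Fin.last k))))
    (fun l : Fin k => M (v l.castSucc) (v l.succ))

/-- The ultra-fication `Ũ(M)`: entry `(i,j)` is the minimax path value
over all finite paths from `i` to `j` in the complete graph with edge
weights `M u v` (the diagonal entries `M i i`, `M j j` always participate
in the max). -/
noncomputable def ultraFy {n : ℕ} (M : Fin n → Fin n → ℝ) : Fin n → Fin n → ℝ :=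
  fun i j => sInf { x | ∃ (k : ℕ) (v : Fin (k + 1) → Fin n),
    v 0 = i ∧ v (Fin.last k) = j ∧ x = pathVal M v }

/-- The entrywise sup distance `‖A - B‖_∞`. -/
noncomputable def supDist {n : ℕ} (A B : Fin n → Fin n → ℝ) : ℝ :=
  sSup { x | ∃ i j, x = |A i j - B i j| }

theorem pathVal_lt_iff {n : ℕ} (M : Fin n → Fin n → ℝ) {k : ℕ} (v : Fin (k + 1) → Fin n)
    (c : ℝ) : pathVal M v < c ↔ (M (v 0) (v 0) < c ∧ M (v (Fin.last k)) (v (Fin.last k)) < c) ∧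
      ∀ l : Fin k, M (v l.castSucc) (v l.succ) < c := by
  simp [pathVal, Finset.fold_max_lt]

theorem exists_path_of_reflTransGen {α : Type*} {r : α → α → Prop} {i j : α}
    (h : Relation.ReflTransGen r i j) :
    ∃ (k : ℕ) (v : Fin (k + 1) → α), v 0 = i ∧ v (Fin.last k) = j ∧
      ∀ l : Fin k, r (v l.castSucc) (v l.succ) := by
  induction h using Relation.ReflTransGen.head_induction_on with
  | refl => exact ⟨0, fun _ => j, rfl, rfl, fun l => l.elim0⟩
  | @head a b hab _ ih =>
    obtain ⟨k, v, h0, hl, hv⟩ := ih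
    refine ⟨k + 1, Fin.cons a v, rfl, ?_, fun l => ?_⟩
    · rw [← Fin.succ_last, Fin.cons_succ, hl]
    · induction l using Fin.cases with
      | zero => simpa [h0] using hab
      | succ l => simpa only [← Fin.succ_castSucc, Fin.cons_succ] using hv l

theorem reflTransGen_of_path {α : Type*} {r : α → α → Prop} {k : ℕ} {v : Fin (k + 1) → α}
    (hv : ∀ l : Fin k, r (v l.castSucc) (v l.succ)) (m : Fin (k + 1)) :
    Relation.ReflTransGen r (v 0) (v m) := by
  induction m using Fin.induction with
  | zero => exact .refl
  | succ l ih => exact ih.tail (hv l)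

theorem ultraFy_lt_iff {n : ℕ} (M : Fin n → Fin n → ℝ) (i j : Fin n) (c : ℝ) :
    ultraFy M i j < c ↔
      M i i < c ∧ M j j < c ∧ Relation.ReflTransGen (fun a b => M a b < c) i j := by
  have hb : BddBelow { x | ∃ (k : ℕ) (v : Fin (k + 1) → Fin n),
      v 0 = i ∧ v (Fin.last k) = j ∧ x = pathVal M v } := by
    refine ⟨M i i, ?_⟩
    rintro x ⟨k, v, rfl, rfl, rfl⟩
    exact le_of_forall_gt fun c hc => ((pathVal_lt_iff M v c).1 hc).1.1
  have hne : { x | ∃ (k : ℕ) (v : Fin (k + 1) → Fin n),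
      v 0 = i ∧ v (Fin.last k) = j ∧ x = pathVal M v }.Nonempty :=
    ⟨_, 1, ![i, j], rfl, rfl, rfl⟩
  rw [ultraFy, csInf_lt_iff hb hne]
  constructor
  · rintro ⟨_, ⟨k, v, rfl, rfl, rfl⟩, hc⟩
    obtain ⟨⟨h0, hl⟩, hv⟩ := (pathVal_lt_iff M v c).1 hc
    exact ⟨h0, hl, reflTransGen_of_path (r := fun a b => M a b < c) hv _⟩
  · rintro ⟨hi, hj, h⟩
    obtain ⟨k, v, rfl, rfl, hv⟩ := exists_path_of_reflTransGen h
    exact ⟨_, ⟨k, v, rfl, rfl, rfl⟩, (pathVal_lt_iff M v c).2 ⟨⟨hi, hj⟩, hv⟩⟩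

theorem IsValid.ultraFy_le {n : ℕ} {M : Fin n → Fin n → ℝ} (hM : IsValid M) (i j : Fin n) :
    ultraFy M i j ≤ M i j :=
  le_of_forall_gt fun c hc => (ultraFy_lt_iff M i j c).2
    ⟨(hM.2 i j).trans_lt hc, ((hM.2 j i).trans_eq (hM.1 j i)).trans_lt hc, .single hc⟩

theorem IsValid.isUltra_ultraFy {n : ℕ} {M : Fin n → Fin n → ℝ} (hM : IsValid M) :
    IsUltra (ultraFy M) := by
  have hsymm (i j : Fin n) : ultraFy M i j ≤ ultraFy M j i := le_of_forall_gt fun c hc => by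
    obtain ⟨hj, hi, h⟩ := (ultraFy_lt_iff M j i c).1 hc
    have : Std.Symm (fun a b => M a b < c) := ⟨fun a b hab => (hM.1 b a).trans_lt hab⟩
    exact (ultraFy_lt_iff M i j c).2 ⟨hi, hj, Std.Symm.symm _ _ h⟩
  refine ⟨⟨fun i j => (hsymm i j).antisymm (hsymm j i), fun i j => ?_⟩, fun i j k => ?_⟩
  · exact (hM.ultraFy_le i i).trans
      (le_of_forall_gt fun c hc => ((ultraFy_lt_iff M i j c).1 hc).1)
  · refine le_of_forall_gt fun c hc => ?_
    obtain ⟨hik, hkj⟩ := max_lt_iff.1 hc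
    obtain ⟨hi, _, h₁⟩ := (ultraFy_lt_iff M i k c).1 hik
    obtain ⟨_, hj, h₂⟩ := (ultraFy_lt_iff M k j c).1 hkj
    exact (ultraFy_lt_iff M i j c).2 ⟨hi, hj, h₁.trans h₂⟩

theorem IsUltra.abs_ultraFy_sub_le {n : ℕ} {A C : Fin n → Fin n → ℝ} (hA : IsUltra A)
    (hC : IsValid C) {d : ℝ} (hd : ∀ i j, |C i j - A i j| ≤ d) (i j : Fin n) :
    |ultraFy C i j - A i j| ≤ d := by
  have hlow : A i j - d ≤ ultraFy C i j := le_of_forall_gt fun c hc => by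
    obtain ⟨hi, -, h⟩ := (ultraFy_lt_iff C i j c).1 hc
    have key : A i j < c + d := by
      clear hc
      induction h with
      | refl => linarith [(abs_le.1 (hd i i)).1]
      | @tail a b _ hab ih =>
        exact (hA.2 i b a).trans_lt (max_lt ih (by linarith [(abs_le.1 (hd a b)).1]))
    linarith
  rw [abs_le]
  constructor <;> linarith [hC.ultraFy_le i j, (abs_le.1 (hd i j)).2]

theorem abs_sub_le_supDist {n : ℕ} (A B : Fin n → Fin n → ℝ) (i j : Fin n) :
    |A i j - B i j| ≤ supDist A B := by
  refine le_csSup ?_ ⟨i, j, rfl⟩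
  refine ((Set.finite_range fun p : Fin n × Fin n => |A p.1 p.2 - B p.1 p.2|).subset ?_).bddAbove
  rintro _ ⟨i, j, rfl⟩
  exact ⟨(i, j), rfl⟩

theorem supDist_le {n : ℕ} (hn : 1 ≤ n) {A B : Fin n → Fin n → ℝ} {d : ℝ}
    (h : ∀ i j, |A i j - B i j| ≤ d) : supDist A B ≤ d := by
  refine csSup_le ⟨_, ⟨0, hn⟩, ⟨0, hn⟩, rfl⟩ ?_
  rintro _ ⟨i, j, rfl⟩
  exact h i j

/-- `U = Ũ(C)`, the ultra-fication of the entrywise 1-center `C` of a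
family of ultra matrices, is itself an ultra matrix and is a 1-center of
the family within the space of ultra matrices with the sup distance. -/
theorem ultraFy_oneCenter {n N : ℕ} (hn : 1 ≤ n) (hN : 1 ≤ N)
    (Ms : Fin N → Fin n → Fin n → ℝ) (hMs : ∀ k, IsUltra (Ms k))
    (C : Fin n → Fin n → ℝ)
    (hC : ∀ i j, C i j =
      (Finset.univ.sup' (Finset.univ_nonempty_iff.mpr ⟨⟨0, hN⟩⟩)
          (fun k => Ms k i j)
        + Finset.univ.inf' (Finset.univ_nonempty_iff.mpr ⟨⟨0, hN⟩⟩)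
          (fun k => Ms k i j)) / 2)
    (U : Fin n → Fin n → ℝ) (hU : U = ultraFy C) :
    IsUltra U ∧
    ∀ V : Fin n → Fin n → ℝ, IsUltra V →
      Finset.univ.sup' (Finset.univ_nonempty_iff.mpr ⟨⟨0, hN⟩⟩)
          (fun k => supDist U (Ms k))
        ≤ Finset.univ.sup' (Finset.univ_nonempty_iff.mpr ⟨⟨0, hN⟩⟩)
          (fun k => supDist V (Ms k)) := by
  subst hU
  have hCv : IsValid C := by
    refine ⟨fun i j => ?_, fun i j => ?_⟩
    · simp only [hC, fun k => (hMs k).1.1 i j]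
    · rw [hC, hC]
      gcongr with k _ k _
      · exact (hMs k).1.2 i j
      · exact (hMs k).1.2 i j
  refine ⟨hCv.isUltra_ultraFy, fun V _ => Finset.sup'_le _ _ fun k _ => supDist_le hn ?_⟩
  refine (hMs k).abs_ultraFy_sub_le hCv fun i j => ?_
  have hV (l : Fin N) := abs_le.1 <| (abs_sub_le_supDist V (Ms l) i j).trans
    (Finset.le_sup' (fun k => supDist V (Ms k)) (Finset.mem_univ l))
  have hle := Finset.le_sup' (fun k => Ms k i j) (Finset.mem_univ k)
  have hge := Finset.inf'_le (fun k => Ms k i j) (Finset.mem_univ k)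
  obtain ⟨a, -, ha⟩ := Finset.exists_mem_eq_sup' ⟨k, Finset.mem_univ k⟩ (fun k => Ms k i j)
  obtain ⟨b, -, hb⟩ := Finset.exists_mem_eq_inf' ⟨k, Finset.mem_univ k⟩ (fun k => Ms k i j)
  rw [hC, ha, hb, abs_le]
  rw [ha] at hle
  rw [hb] at hge
  constructor <;> linarith [(hV a).1, (hV b).2]
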